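/- (Theorem 3, main result: cubic degree growth.) For every n ≥ 0, the common degree d_n of the four homogeneous components of the reduced n-th iterate of φ̃ equals d_n = 17/16 + (5/12)n + (3/8)n² + (1/12)n³ − (1/16)(−1)ⁿ; in particular the degree growth of the iterates of the birational map φ̃ is cubic and its algebraic entropy lim_{n→∞} (1/n)·log d_n is zero. -/

import Mathlib

open MvPolynomial

/-- The field `K = ℚ(a,b,c,d)` of rational functions in four independent
transcendental parameters. -/
abbrev Kfield : Type := FractionRing (MvPolynomial (Fin 4) ℚ)

/-- The parameters `a, b, c, d` as elements of `K`. -/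
noncomputable def pa : Kfield := algebraMap (MvPolynomial (Fin 4) ℚ) Kfield (X 0)
noncomputable def pb : Kfield := algebraMap (MvPolynomial (Fin 4) ℚ) Kfield (X 1)
noncomputable def pc : Kfield := algebraMap (MvPolynomial (Fin 4) ℚ) Kfield (X 2)
noncomputable def pd : Kfield := algebraMap (MvPolynomial (Fin 4) ℚ) Kfield (X 3)

/-- The four homogeneous quadratic components of the map φ̃, as polynomials in
`K[x,y,z,t]` with `x = X 0`, `y = X 1`, `z = X 2`, `t = X 3`. -/
noncomputable def phiT : Fin 4 → MvPolynomial (Fin 4) Kfield :=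
  ![ -C pa * X 3 ^ 2 - C pb * (X 0 + X 1) * X 3 - C pc * (X 0 + X 1 + X 2) * X 3
       - C pd * (X 0 + X 1) * (2 * X 0 + 2 * X 1 + X 2),
     X 0 * (C pc * X 3 + C pd * (X 0 + X 1)),
     X 1 * (C pc * X 3 + C pd * (X 0 + X 1)),
     X 3 * (C pc * X 3 + C pd * (X 0 + X 1)) ]

/-- The raw (unreduced) `n`-th iterate of the polynomial map φ̃. -/
noncomputable def rawIter : ℕ → Fin 4 → MvPolynomial (Fin 4) Kfield
  | 0 => fun i => X i
  | n + 1 => fun i => aeval (rawIter n) (phiT i)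

namespace CubicGrowth

section Somos

variable {R : Type*} [CommRing R]

theorem isRelPrime_of_mul_eq {x u y v z : R} (h : x * u = y * v + z) (hyz : IsRelPrime y z) :
    IsRelPrime x y := fun _ hx hy =>
  hyz hy ((dvd_add_right (hy.mul_right v)).1 (h ▸ hx.mul_right u))

/-- The quotient `b / a` when `a ∣ b`, and `0` otherwise. -/
noncomputable def exactQuot (a b : R) : R :=
  open Classical in if h : a ∣ b then h.choose else 0

theorem exactQuot_mul {a b : R} (h : a ∣ b) : exactQuot a b * a = b := by
  rw [exactQuot, dif_pos h, mul_comm]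
  exact h.choose_spec.symm

/-- The Somos-5 sequence with coefficients `A`, `B` and initial values `u, v, 1, 1, 1`. -/
noncomputable def somos (A B u v : R) : ℕ → R
  | 0 => u
  | 1 => v
  | 2 => 1
  | 3 => 1
  | 4 => 1
  | n + 5 => exactQuot (somos A B u v n)
      (A * somos A B u v (n + 4) * somos A B u v (n + 1) +
        B * somos A B u v (n + 3) * somos A B u v (n + 2))

/-- The Somos-5 relation at index `n`. -/
def SomosRel (A B : R) (T : ℕ → R) (n : ℕ) : Prop :=
  T (n + 5) * T n = A * T (n + 4) * T (n + 1) + B * T (n + 3) * T (n + 2)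

/-- Five consecutive terms are coprime to each other and to the two coefficients. -/
structure SomosWindow (A B : R) (T : ℕ → R) (n : ℕ) : Prop where
  pair : ∀ i j, i < j → j < 5 → IsRelPrime (T (n + i)) (T (n + j))
  left : ∀ i, i < 5 → IsRelPrime (T (n + i)) A
  right : ∀ i, i < 5 → IsRelPrime (T (n + i)) B

variable {A B : R} {T : ℕ → R} {n : ℕ}

theorem somos_rel_of_dvd {u v : R}
    (h : somos A B u v n ∣ A * somos A B u v (n + 4) * somos A B u v (n + 1) +
      B * somos A B u v (n + 3) * somos A B u v (n + 2)) :
    SomosRel A B (somos A B u v) n := by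
  rw [SomosRel, somos, exactQuot_mul h]

variable [DecompositionMonoid R]

theorem SomosWindow.succ (hAB : IsRelPrime A B) (h : SomosWindow A B T n)
    (hr : SomosRel A B T n) : SomosWindow A B T (n + 1) := by
  have l := h.left
  have r := h.right
  have p := h.pair
  have e5 : ∀ i, i < 4 → IsRelPrime (T (n + 5)) (T (n + (i + 1))) := by
    unfold SomosRel at hr
    intro i hi
    interval_cases i
    · exact isRelPrime_of_mul_eq (u := T n) (v := A * T (n + 4))
        (z := B * T (n + 3) * T (n + 2)) (by rw [hr]; ring)
        (((r 1 (by simp)).mul_right (p 1 3 (by simp) (by simp))).mul_right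
          (p 1 2 (by simp) (by simp)))
    · exact isRelPrime_of_mul_eq (u := T n) (v := B * T (n + 3))
        (z := A * T (n + 4) * T (n + 1)) (by rw [hr]; ring)
        (((l 2 (by simp)).mul_right (p 2 4 (by simp) (by simp))).mul_right
          (p 1 2 (by simp) (by simp)).symm)
    · exact isRelPrime_of_mul_eq (u := T n) (v := B * T (n + 2))
        (z := A * T (n + 4) * T (n + 1)) (by rw [hr]; ring)
        (((l 3 (by simp)).mul_right (p 3 4 (by simp) (by simp))).mul_right
          (p 1 3 (by simp) (by simp)).symm)
    · exact isRelPrime_of_mul_eq (u := T n) (v := A * T (n + 1))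
        (z := B * T (n + 3) * T (n + 2)) (by rw [hr]; ring)
        (((r 4 (by simp)).mul_right (p 3 4 (by simp) (by simp)).symm).mul_right
          (p 2 4 (by simp) (by simp)).symm)
  have eA : IsRelPrime (T (n + 5)) A :=
    isRelPrime_of_mul_eq (u := T n) (v := T (n + 4) * T (n + 1))
      (z := B * T (n + 3) * T (n + 2)) (by rw [hr]; ring)
      ((hAB.mul_right (l 3 (by simp)).symm).mul_right (l 2 (by simp)).symm)
  have eB : IsRelPrime (T (n + 5)) B :=
    isRelPrime_of_mul_eq (u := T n) (v := T (n + 3) * T (n + 2))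
      (z := A * T (n + 4) * T (n + 1)) (by rw [hr]; ring)
      ((hAB.symm.mul_right (r 4 (by simp)).symm).mul_right (r 1 (by simp)).symm)
  refine ⟨fun i j hij hj => ?_, fun i hi => ?_, fun i hi => ?_⟩
  · rw [add_assoc, add_assoc, add_comm 1, add_comm 1]
    rcases Nat.lt_succ_iff_lt_or_eq.1 hj with hj | rfl
    · exact p _ _ (by lia) (by lia)
    · exact (e5 i hij).symm
  · rw [add_assoc, add_comm 1]
    rcases Nat.lt_succ_iff_lt_or_eq.1 hi with hi | rfl
    · exact l _ (by lia)
    · exact eA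
  · rw [add_assoc, add_comm 1]
    rcases Nat.lt_succ_iff_lt_or_eq.1 hi with hi | rfl
    · exact r _ (by lia)
    · exact eB

/-- The divisibility behind the integrality of Somos-5 sequences. -/
theorem SomosWindow.dvd (h : SomosWindow A B T (n + 1)) (h0 : SomosRel A B T n)
    (h1 : SomosRel A B T (n + 1)) (h2 : SomosRel A B T (n + 2)) (h3 : SomosRel A B T (n + 3))
    (h4 : SomosRel A B T (n + 4)) :
    T (n + 5) ∣ A * T (n + 9) * T (n + 6) + B * T (n + 8) * T (n + 7) := by
  have p : ∀ i, i < 4 → IsRelPrime (T (n + 5)) (T (n + (i + 1))) := fun i hi => by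
    have := (h.pair i 4 hi (by simp)).symm
    rwa [add_assoc, add_assoc, add_comm 1, add_comm 1] at this
  have hp := (((p 0 (by simp)).mul_right (p 1 (by simp))).mul_right (p 2 (by simp))).mul_right
    (p 3 (by simp))
  refine hp.dvd_of_dvd_mul_left ⟨A ^ 2 * T (n + 6) * T (n + 8) * T (n + 1) * T (n + 2) * T (n + 3)
    + B ^ 2 * T (n + 7) * T (n + 6) * T (n + 1) * T (n + 2) * T (n + 4)
    + A * B * T (n + 7) * (T (n + 1) * B * T (n + 4) ^ 3
      + T (n + 3) * T (n + 6) * (A * T (n + 2) ^ 2 + T (n + 4) * T n)), ?_⟩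
  simp only [SomosRel, add_assoc, Nat.reduceAdd, zero_add] at h0 h1 h2 h3 h4 ⊢
  linear_combination A * T (n + 6) * T (n + 1) * T (n + 2) * T (n + 3) * h4
    + B * T (n + 7) * T (n + 1) * T (n + 2) * T (n + 4) * h3
    + A * B * T (n + 7) * T (n + 1) * T (n + 4) ^ 2 * h2
    + A * B * T (n + 7) * T (n + 3) * T (n + 6) * T (n + 2) * h1
    - A * B * T (n + 7) * T (n + 3) * T (n + 6) * T (n + 4) * h0

theorem somos_rel_window [IsDomain R] {m l u : R} (hu : u ≠ 0) (hA : IsRelPrime A B)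
    (hml : IsRelPrime m l)
    (hmA : IsRelPrime m A) (hmB : IsRelPrime m B) (hlA : IsRelPrime l A) (hlB : IsRelPrime l B)
    (h0 : l * u = A * m + B) (h1 : m ∣ A * l + B) :
    somos A B u m 5 = l ∧
    ∀ n, SomosRel A B (somos A B u m) n ∧ SomosWindow A B (somos A B u m) (n + 1) := by
  set T := somos A B u m with hT
  have t0 : T 0 = u := by rw [hT, somos]
  have t1 : T 1 = m := by rw [hT, somos]
  have t2 : T 2 = 1 := by rw [hT, somos]
  have t3 : T 3 = 1 := by rw [hT, somos]
  have t4 : T 4 = 1 := by rw [hT, somos]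
  have r0 : SomosRel A B T 0 := somos_rel_of_dvd ⟨l, by
    change A * T 4 * T 1 + B * T 3 * T 2 = T 0 * l
    rw [t4, t1, t3, t2, t0]; linear_combination -h0⟩
  have t5 : T 5 = l := by
    have := r0
    simp only [SomosRel, zero_add, t4, t1, t3, t2, t0, mul_one, ← h0] at this
    exact mul_right_cancel₀ hu this
  have r1 : SomosRel A B T 1 := somos_rel_of_dvd (by
    change T 1 ∣ A * T 5 * T 2 + B * T 4 * T 3
    simpa only [t5, t2, t4, t1, t3, mul_one] using h1)
  have r2 : SomosRel A B T 2 := somos_rel_of_dvd (by change T 2 ∣ _; rw [t2]; exact one_dvd _)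
  have r3 : SomosRel A B T 3 := somos_rel_of_dvd (by change T 3 ∣ _; rw [t3]; exact one_dvd _)
  have r4 : SomosRel A B T 4 := somos_rel_of_dvd (by change T 4 ∣ _; rw [t4]; exact one_dvd _)
  have w1 : SomosWindow A B T 1 := by
    refine ⟨fun i j hij hj => ?_, fun i hi => ?_, fun i hi => ?_⟩
    · interval_cases j <;> interval_cases i <;>
        simp only [Nat.reduceAdd, add_zero, t1, t2, t3, t4, t5, hml, isRelPrime_one_left,
          isRelPrime_one_right]
    · interval_cases i <;>
        simp only [Nat.reduceAdd, add_zero, t1, t2, t3, t4, t5, hmA, hlA, isRelPrime_one_left]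
    · interval_cases i <;>
        simp only [Nat.reduceAdd, add_zero, t1, t2, t3, t4, t5, hmB, hlB, isRelPrime_one_left]
  refine ⟨t5, fun n => ?_⟩
  have key : SomosRel A B T n ∧ SomosRel A B T (n + 1) ∧ SomosRel A B T (n + 2) ∧
      SomosRel A B T (n + 3) ∧ SomosRel A B T (n + 4) ∧ SomosWindow A B T (n + 1) := by
    induction n with
    | zero => exact ⟨r0, r1, r2, r3, r4, w1⟩
    | succ n ih =>
      obtain ⟨h0, h1, h2, h3, h4, hw⟩ := ih
      exact ⟨h1, h2, h3, h4, somos_rel_of_dvd (hw.dvd h0 h1 h2 h3 h4), hw.succ hA h1⟩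
  exact ⟨key.1, key.2.2.2.2.2⟩

end Somos

section Tau

variable {R : Type*} [CommRing R]

/-- The cubic invariant of the map `(m, l) ↦ (l, be * t - l - m + al * t ^ 2 / l)`. -/
def cubicInv (al be t m l : R) : R := l * m * (l + m - be * t) - al * t ^ 2 * (l + m)

/-- `T` is a sequence of tau functions: with
`w n = T (n + 4) * T (n + 1) / (t * T (n + 3) * T (n + 2))` one has `w 0 = m / t`,
`w 1 = l / t` and `w (n + 2) + w (n + 1) + w n = be + al / w (n + 1)`. -/
structure IsTau (al be t m l : R) (T : ℕ → R) : Prop where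
  one : T 1 = m
  two : T 2 = 1
  three : T 3 = 1
  four : T 4 = 1
  five : T 5 = l
  rel : ∀ n, T (n + 5) * T n =
    -(al * t ^ 2) * T (n + 4) * T (n + 1) + -cubicInv al be t m l * T (n + 3) * T (n + 2)
  pair : ∀ i j, 1 ≤ i → i < j → j < i + 5 → IsRelPrime (T i) (T j)
  prime_t : ∀ i, 1 ≤ i → IsRelPrime (T i) t
  ne_zero : ∀ i, 1 ≤ i → T i ≠ 0

variable {al be t m l : R} {T : ℕ → R}

theorem IsTau.additive [IsDomain R] (h : IsTau al be t m l T) (n : ℕ) :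
    T (n + 6) * T (n + 3) ^ 2 * T (n + 2) + T (n + 5) ^ 2 * T (n + 2) ^ 2
      + T (n + 4) ^ 2 * T (n + 5) * T (n + 1)
    = be * t * T (n + 2) * T (n + 3) * T (n + 4) * T (n + 5)
      + al * t ^ 2 * T (n + 4) ^ 2 * T (n + 3) ^ 2 := by
  have key : ∀ n, T (n + 1) * T (n + 5) * (T (n + 4) ^ 2 * T (n + 1) + T (n + 5) * T (n + 2) ^ 2
        - be * t * T (n + 2) * T (n + 3) * T (n + 4))
      - al * t ^ 2 * T (n + 3) ^ 2 * (T (n + 4) ^ 2 * T (n + 1) + T (n + 5) * T (n + 2) ^ 2)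
      = cubicInv al be t m l * T (n + 2) * T (n + 3) ^ 3 * T (n + 4) →
    T (n + 6) * T (n + 3) ^ 2 * T (n + 2) + T (n + 5) ^ 2 * T (n + 2) ^ 2
      + T (n + 4) ^ 2 * T (n + 5) * T (n + 1)
    = be * t * T (n + 2) * T (n + 3) * T (n + 4) * T (n + 5)
      + al * t ^ 2 * T (n + 4) ^ 2 * T (n + 3) ^ 2 := by
    intro n hn
    have hr := h.rel (n + 1)
    simp only [add_assoc, Nat.reduceAdd] at hr
    refine mul_left_cancel₀ (h.ne_zero (n + 1) (by lia)) ?_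
    linear_combination hn + T (n + 3) ^ 2 * T (n + 2) * hr
  refine key n ?_
  induction n with
  | zero =>
    simp only [zero_add, h.one, h.two, h.three, h.four, h.five, cubicInv]
    ring
  | succ n ih =>
    have ha := key n ih
    have hr := h.rel (n + 1)
    simp only [add_assoc, Nat.reduceAdd] at hr ⊢
    linear_combination T (n + 6) * ha - T (n + 4) ^ 2 * T (n + 5) * hr

theorem isRelPrime_of_dvd_prime {q x y : R} (hq : Prime q) (hx : q ∣ x) (h : IsRelPrime x y) :
    ¬ q ∣ y := fun hy => hq.not_isUnit (h hx hy)

theorem exists_derivation_extension {R : Type*} [CommRing R] [IsDomain R] (F : Type*) [Field F]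
    [Algebra R F] [IsFractionRing R F] (δ : Derivation ℤ R R) :
    ∃ D : Derivation ℤ F F, ∀ r, D (algebraMap R F r) = algebraMap R F (δ r) := by
  let f : R →+* TrivSqZeroExt F F :=
    { toFun := fun r => TrivSqZeroExt.inl (algebraMap R F r) +
        TrivSqZeroExt.inr (algebraMap R F (δ r))
      map_one' := by ext <;> simp
      map_mul' := fun x y => by
        ext <;> simp only [TrivSqZeroExt.fst_add, TrivSqZeroExt.fst_inl, TrivSqZeroExt.fst_inr,
          TrivSqZeroExt.snd_add, TrivSqZeroExt.snd_inl, TrivSqZeroExt.snd_inr,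
          TrivSqZeroExt.fst_mul, TrivSqZeroExt.snd_mul, op_smul_eq_smul, smul_eq_mul,
          Derivation.leibniz, map_add, map_mul, zero_add, add_zero]
      map_zero' := by ext <;> simp
      map_add' := fun x y => by ext <;> simp [Algebra.smul_def] }
  have hf : ∀ y : nonZeroDivisors R, IsUnit (f y) := fun y => by
    rw [TrivSqZeroExt.isUnit_iff_isUnit_fst]
    simp [f]
  let g : F →+* TrivSqZeroExt F F := IsLocalization.lift hf
  have hg : ∀ r, g (algebraMap R _ r) = f r := fun r => IsLocalization.lift_eq hf r
  have hfst : ∀ x, (g x).fst = x := fun x => by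
    have : (TrivSqZeroExt.fstHom F F F).toRingHom.comp g
        = RingHom.id _ := IsLocalization.ringHom_ext (nonZeroDivisors R) (by
          ext r
          simp [hg, f])
    exact congrArg (fun φ : F →+* F => φ x) this
  refine ⟨Derivation.mk' ((TrivSqZeroExt.sndHom F F).toAddMonoidHom.comp
    g.toAddMonoidHom).toIntLinearMap ?_, ?_⟩
  · intro x y
    change (g (x * y)).snd = x • (g y).snd + y • (g x).snd
    rw [map_mul, TrivSqZeroExt.snd_mul, hfst, hfst, op_smul_eq_smul]
  · intro r
    change (g _).snd = _
    rw [hg]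
    change (TrivSqZeroExt.inl _ + TrivSqZeroExt.inr _ : TrivSqZeroExt F F).snd = _
    rw [TrivSqZeroExt.snd_add, TrivSqZeroExt.snd_inl, TrivSqZeroExt.snd_inr, zero_add]

/-- Along the Hamiltonian vector field of the invariant, the functions
`w n = T (n + 4) * T (n + 1) / (t * T (n + 3) * T (n + 2))` obey the Hamiltonian equations
in each chart `(w n, w (n + 1))`. -/
theorem IsTau.derivation_eq [IsDomain R] (h : IsTau al be t m l T) (ht : t ≠ 0) {F : Type*}
    [Field F] [Algebra R F] [IsFractionRing R F] {D : Derivation ℤ F F} {ι : R →+* F}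
    (hι : ι = algebraMap R F)
    (hDt : D (ι t) = 0) (hDal : D (ι al) = 0) (hDbe : D (ι be) = 0)
    (hDm : D (ι m) = ι (m * (m + 2 * l - be * t) - al * t ^ 2))
    (hDl : D (ι l) = -ι (l * (l + 2 * m - be * t) - al * t ^ 2)) {w : ℕ → F}
    (hw : ∀ n, w n = ι (T (n + 4) * T (n + 1)) / ι (t * T (n + 3) * T (n + 2))) (n : ℕ) :
    D (w n) = ι t * (w n * (w n + 2 * w (n + 1) - ι be) - ι al) ∧
    D (w (n + 1)) = -(ι t * (w (n + 1) * (w (n + 1) + 2 * w n - ι be) - ι al)) := by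
  have hne : ∀ {r : R}, r ≠ 0 → ι r ≠ 0 := fun hr => by
    rw [hι]; exact (map_ne_zero_iff _ (IsFractionRing.injective R F)).2 hr
  have ht' := hne ht
  have hT : ∀ i, 1 ≤ i → ι (T i) ≠ 0 := fun i hi => hne (h.ne_zero i hi)
  have hw0 : ∀ n, w n ≠ 0 := fun n => by
    rw [hw]
    simp only [map_mul]
    have h1 := hT (n + 1) (by lia)
    have h2 := hT (n + 2) (by lia)
    have h3 := hT (n + 3) (by lia)
    have h4 := hT (n + 4) (by lia)
    positivity
  have hadd : ∀ n, w (n + 2) = ι be - w (n + 1) - w n + ι al / w (n + 1) := fun n => by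
    have e := congrArg ι (h.additive n)
    have h1 := hT (n + 1) (by lia)
    have h2 := hT (n + 2) (by lia)
    have h3 := hT (n + 3) (by lia)
    have h4 := hT (n + 4) (by lia)
    have h5 := hT (n + 5) (by lia)
    have h6 := hT (n + 6) (by lia)
    simp only [map_add, map_mul, map_pow] at e
    simp only [hw, map_mul, add_assoc, Nat.reduceAdd]
    field_simp
    linear_combination e
  induction n with
  | zero =>
    have e0 : w 0 = ι m / ι t := by simp [hw, h.four, h.one, h.three, h.two]
    have e1 : w 1 = ι l / ι t := by simp [hw, h.four, h.five, h.three, h.two]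
    rw [zero_add, e0, e1, Derivation.leibniz_div_const _ _ _ hDt,
      Derivation.leibniz_div_const _ _ _ hDt, hDm, hDl]
    simp only [map_sub, map_mul, map_add, map_pow, smul_eq_mul, map_ofNat]
    constructor <;> field_simp
  | succ n ih =>
    obtain ⟨h0, h1⟩ := ih
    have w1 := hw0 (n + 1)
    refine ⟨?_, ?_⟩
    · rw [h1, add_assoc, hadd]
      field_simp
      ring
    · change D (w (n + 2)) = -(ι t * (w (n + 2) * (w (n + 2) + 2 * w (n + 1) - ι be) - ι al))
      rw [hadd n]
      simp only [map_add, map_sub, hDbe, Derivation.leibniz_div, hDal, h0, h1, smul_eq_mul]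
      field_simp
      ring

/-- `δ` is the Hamiltonian vector field of `cubicInv al be t m l` in the variables `m` and `l`. -/
structure IsHamiltonian (al be t m l : R) (δ : R → R) : Prop where
  map_t : δ t = 0
  map_al : δ al = 0
  map_be : δ be = 0
  map_m : δ m = m * (m + 2 * l - be * t) - al * t ^ 2
  map_l : δ l = -(l * (l + 2 * m - be * t) - al * t ^ 2)

theorem IsTau.not_dvd_derivation [IsDomain R] (h : IsTau al be t m l T) (hal : IsUnit al)
    {δ : Derivation ℤ R R} (hδ : IsHamiltonian al be t m l δ) {q : R} (hq : Prime q) {n : ℕ}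
    (hqT : q ∣ T (n + 5)) : ¬ q ∣ δ (T (n + 5)) := by
  intro hqd
  have hqt : ¬ q ∣ t := isRelPrime_of_dvd_prime hq hqT (h.prime_t _ (by lia))
  have ht : t ≠ 0 := fun h0 => hqt (h0 ▸ dvd_zero q)
  have hqn : ∀ i, n + 1 ≤ i → i < n + 5 → ¬ q ∣ T i := fun i hi hi' =>
    isRelPrime_of_dvd_prime hq hqT (h.pair _ _ (by lia) hi' (by lia)).symm
  obtain ⟨D, hD⟩ := exists_derivation_extension (FractionRing R) δ
  set ι := algebraMap R (FractionRing R) with hι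
  have key := (h.derivation_eq ht (D := D) hι (by rw [hD, hδ.map_t, map_zero])
    (by rw [hD, hδ.map_al, map_zero]) (by rw [hD, hδ.map_be, map_zero])
    (by rw [hD, hδ.map_m]) (by rw [hD, hδ.map_l, map_neg]) (fun _ => rfl) n).2
  have hinj : Function.Injective ι := IsFractionRing.injective R _
  have hne : ∀ {r : R}, r ≠ 0 → ι r ≠ 0 := fun hr => (map_ne_zero_iff _ hinj).2 hr
  have ht' := hne ht
  have h1 := hne (h.ne_zero (n + 1) (by lia))
  have h2 := hne (h.ne_zero (n + 2) (by lia))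
  have h3 := hne (h.ne_zero (n + 3) (by lia))
  have h4 := hne (h.ne_zero (n + 4) (by lia))
  simp only [add_assoc, Nat.reduceAdd, Derivation.leibniz_div, hD, smul_eq_mul] at key
  generalize hP : T (n + 5) * T (n + 2) = P at key
  generalize hQ : t * T (n + 4) * T (n + 3) = Q at key
  generalize hP' : T (n + 4) * T (n + 1) = P' at key
  generalize hQ' : t * T (n + 3) * T (n + 2) = Q' at key
  have hqP : q ∣ P := hP ▸ hqT.mul_right _
  have hqδP : q ∣ δ P := by
    rw [← hP, Derivation.leibniz]
    exact dvd_add (hqT.mul_right _) (hqd.mul_left _)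
  have hqQ : ¬ q ∣ Q := by
    rw [← hQ]
    exact hq.not_dvd_mul (hq.not_dvd_mul hqt (hqn _ (by lia) (by lia))) (hqn _ (by lia) (by lia))
  have hqQ' : ¬ q ∣ Q' := by
    rw [← hQ']
    exact hq.not_dvd_mul (hq.not_dvd_mul hqt (hqn _ (by lia) (by lia))) (hqn _ (by lia) (by lia))
  have hQ0 : ι Q ≠ 0 := hne fun h0 => hqQ (h0 ▸ dvd_zero q)
  have hQ0' : ι Q' ≠ 0 := hne fun h0 => hqQ' (h0 ▸ dvd_zero q)
  field_simp at key
  have key' : Q' * (Q * δ P - P * δ Q)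
      = -(t * (P * (P * Q' + 2 * P' * Q - be * Q * Q') - al * Q ^ 2 * Q')) := by
    apply hinj
    simp only [map_mul, map_sub, map_neg, map_add, map_pow, map_ofNat]
    linear_combination key
  have : q ∣ t * (al * (Q ^ 2 * Q')) := by
    have e : t * (al * (Q ^ 2 * Q')) = P * (t * (P * Q' + 2 * P' * Q - be * Q * Q') - Q' * δ Q)
        + δ P * (Q' * Q) := by linear_combination -key'
    rw [e]
    exact dvd_add (hqP.mul_right _) (hqδP.mul_right _)
  rcases hq.dvd_or_dvd this with h0 | h0
  · exact hqt h0
  rcases hq.dvd_or_dvd h0 with h0 | h0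
  · exact hq.not_isUnit (isUnit_of_dvd_unit h0 hal)
  rcases hq.dvd_or_dvd h0 with h0 | h0
  · exact hqQ (hq.dvd_of_dvd_pow h0)
  · exact hqQ' h0

end Tau

section Lead

variable {K κ : Type*} [Field K] [Field κ] [Algebra K κ]

/-- `v` is a rational function of `s` over `K` whose expansion at infinity is
`c * s ^ e + (lower order terms)`; the coefficient `c` may vanish. -/
def Lead (s v : κ) (c : K) (e : ℤ) : Prop :=
  ∃ (P Q : Polynomial K) (a b : ℕ), P.natDegree ≤ a ∧ P.coeff a = c ∧ Q.natDegree ≤ b ∧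
    Q.coeff b = 1 ∧ v * Polynomial.aeval s Q = Polynomial.aeval s P ∧ (a : ℤ) = b + e

variable {s v w : κ} {c c' : K} {e e' : ℤ}

theorem aeval_ne_zero_of_coeff (hs : Transcendental K s) {P : Polynomial K} {a : ℕ}
    (h : P.coeff a ≠ 0) : Polynomial.aeval s P ≠ 0 := fun h0 =>
  h (by rw [transcendental_iff.1 hs P h0, Polynomial.coeff_zero])

theorem Lead.ne_zero (hs : Transcendental K s) (h : Lead s v c e) (hc : c ≠ 0) : v ≠ 0 := by
  obtain ⟨P, Q, a, b, -, hP, -, hQ, hv, -⟩ := h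
  rintro rfl
  exact aeval_ne_zero_of_coeff hs (hP ▸ hc) (by rw [← hv, zero_mul])

theorem Lead.mul (h : Lead s v c e) (h' : Lead s w c' e') : Lead s (v * w) (c * c') (e + e') := by
  obtain ⟨P, Q, a, b, hPa, hP, hQb, hQ, hv, hab⟩ := h
  obtain ⟨P', Q', a', b', hPa', hP', hQb', hQ', hv', hab'⟩ := h'
  refine ⟨P * P', Q * Q', a + a', b + b', Polynomial.natDegree_mul_le_of_le hPa hPa', ?_,
    Polynomial.natDegree_mul_le_of_le hQb hQb', ?_, ?_, by push_cast; lia⟩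
  · rw [Polynomial.coeff_mul_add_eq_of_natDegree_le hPa hPa', hP, hP']
  · rw [Polynomial.coeff_mul_add_eq_of_natDegree_le hQb hQb', hQ, hQ', one_mul]
  · rw [map_mul, map_mul, ← hv, ← hv']; ring

theorem Lead.inv (hs : Transcendental K s) (h : Lead s v c e) (hc : c ≠ 0) :
    Lead s v⁻¹ c⁻¹ (-e) := by
  have hv0 := h.ne_zero hs hc
  obtain ⟨P, Q, a, b, hPa, hP, hQb, hQ, hv, hab⟩ := h
  refine ⟨Polynomial.C c⁻¹ * Q, Polynomial.C c⁻¹ * P, b, a,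
    Polynomial.natDegree_C_mul_le _ _ |>.trans hQb, ?_,
    Polynomial.natDegree_C_mul_le _ _ |>.trans hPa, ?_, ?_, by lia⟩
  · rw [Polynomial.coeff_C_mul, hQ, mul_one]
  · rw [Polynomial.coeff_C_mul, hP, inv_mul_cancel₀ hc]
  · rw [map_mul, map_mul, ← hv]; field_simp

theorem Lead.sub (h : Lead s v c e) (h' : Lead s w c' e) : Lead s (v - w) (c - c') e := by
  obtain ⟨P, Q, a, b, hPa, hP, hQb, hQ, hv, hab⟩ := h
  obtain ⟨P', Q', a', b', hPa', hP', hQb', hQ', hv', hab'⟩ := h'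
  have e0 : b + a' = a + b' := by lia
  refine ⟨P * Q' - Q * P', Q * Q', a + b', b + b',
    Polynomial.natDegree_sub_le_of_le (Polynomial.natDegree_mul_le_of_le hPa hQb')
      (Polynomial.natDegree_mul_le_of_le hQb hPa') |>.trans (by rw [e0, max_self]), ?_,
    Polynomial.natDegree_mul_le_of_le hQb hQb', ?_, ?_, by push_cast; lia⟩
  · rw [Polynomial.coeff_sub, Polynomial.coeff_mul_add_eq_of_natDegree_le hPa hQb', ← e0,
      Polynomial.coeff_mul_add_eq_of_natDegree_le hQb hPa', hP, hP', hQ, hQ', mul_one, one_mul]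
  · rw [Polynomial.coeff_mul_add_eq_of_natDegree_le hQb hQb', hQ, hQ', one_mul]
  · rw [map_sub, map_mul, map_mul, map_mul, ← hv, ← hv']; ring

theorem Lead.of_lt (h : Lead s v c e) (he : e < e') : Lead s v (0 : K) e' := by
  obtain ⟨P, Q, a, b, hPa, hP, hQb, hQ, hv, hab⟩ := h
  obtain ⟨k, rfl⟩ : ∃ k : ℕ, e' = e + (k + 1 : ℕ) := ⟨(e' - e - 1).toNat, by push_cast; lia⟩
  exact ⟨P, Q, a + (k + 1), b, by lia, Polynomial.coeff_eq_zero_of_natDegree_lt (by lia), hQb, hQ,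
    hv, by push_cast; lia⟩

theorem Lead.const (s : κ) (c : K) : Lead s (algebraMap K κ c) c 0 :=
  ⟨Polynomial.C c, 1, 0, 0, by simp, by simp, by simp, by simp, by simp, by simp⟩

theorem Lead.self (s : κ) : Lead s s (1 : K) 1 :=
  ⟨Polynomial.X, 1, 1, 0, Polynomial.natDegree_X_le, by simp, by simp, by simp, by simp, by simp⟩

/-- The solution of a QRT-type recursion starting next to a pole never vanishes. -/
theorem ne_zero_of_recursion [CharZero K] (hs : Transcendental K s) {α β : K} (hα : α ≠ 0)
    {v : ℕ → κ} (h1 : v 1 = s) (h2 : v 2 = algebraMap K κ β - s + algebraMap K κ α * s⁻¹)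
    (hrec : ∀ i, 1 ≤ i → v (i + 1) ≠ 0 →
      v (i + 2) * (v (i + 1) * v i) = algebraMap K κ α * (s - v (i + 1))) (i : ℕ) (hi : 1 ≤ i) :
    v i ≠ 0 := by
  have step : ∀ {i : ℕ} {c c' c'' : K} {e e' : ℤ}, 1 ≤ i → Lead s (v i) c e →
      Lead s (v (i + 1)) c' e' → c ≠ 0 → c' ≠ 0 → Lead s (v (i + 1)) c'' 1 →
      Lead s (v (i + 2)) (α * (1 - c'') * (c' * c)⁻¹) (1 + -(e' + e)) := by
    intro i c c' c'' e e' hi h h' hc hc' h''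
    have hv := h.ne_zero hs hc
    have hv' := h'.ne_zero hs hc'
    have key := ((Lead.const s α).mul ((Lead.self s).sub h'')).mul
      ((h'.mul h).inv hs (mul_ne_zero hc' hc))
    rw [zero_add] at key
    convert key using 1
    rw [← hrec i hi hv']
    field_simp
  have third : ∀ j : ℕ, Lead s (v (3 * j + 1)) ((j + 1 : K)⁻¹) 1 →
      Lead s (v (3 * j + 2)) (-(j + 1 : K)⁻¹) 1 →
      Lead s (v (3 * j + 3)) (-(α * ((j : K) + 1) * (j + 1 + 1))) (-1) := by
    intro j l1 l2
    have hj := Nat.cast_add_one_ne_zero (R := K) j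
    convert step (by lia) l1 l2 (inv_ne_zero hj) (neg_ne_zero.2 (inv_ne_zero hj)) l2 using 1
    · field_simp
      ring
    · norm_num
  have coeff_ne : ∀ j : ℕ, -(α * ((j : K) + 1) * (j + 1 + 1)) ≠ 0 := fun j =>
    neg_ne_zero.2 (mul_ne_zero (mul_ne_zero hα (Nat.cast_add_one_ne_zero j))
      (by exact_mod_cast Nat.cast_add_one_ne_zero (R := K) (j + 1)))
  have main : ∀ j : ℕ, Lead s (v (3 * j + 1)) ((j + 1 : K)⁻¹) 1 ∧
      Lead s (v (3 * j + 2)) (-(j + 1 : K)⁻¹) 1 := by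
    intro j
    induction j with
    | zero =>
      refine ⟨by simpa [h1] using Lead.self s, ?_⟩
      have := (((Lead.const s β).of_lt (e' := 1) (by simp)).sub (Lead.self s)).sub
        (((Lead.const s (-α)).mul ((Lead.self s).inv hs one_ne_zero)).of_lt (e' := 1) (by simp))
      simpa [h2] using this
    | succ j ih =>
      obtain ⟨l1, l2⟩ := ih
      have hj := Nat.cast_add_one_ne_zero (R := K) j
      have hj' : (j + 1 + 1 : K) ≠ 0 := by exact_mod_cast Nat.cast_add_one_ne_zero (R := K) (j + 1)
      have l3 := third j l1 l2
      have a3 := coeff_ne j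
      have l4 := step (by lia) l2 l3 (neg_ne_zero.2 (inv_ne_zero hj)) a3
        (l3.of_lt (e' := 1) (by norm_num))
      have l4' : Lead s (v (3 * j + 4)) ((j + 1 + 1 : K)⁻¹) 1 := by
        convert l4 using 1
        · field_simp
          ring
        · norm_num
      have l5 := step (by lia) l3 l4' a3 (inv_ne_zero hj') l4'
      have l5' : Lead s (v (3 * j + 5)) (-(j + 1 + 1 : K)⁻¹) 1 := by
        convert l5 using 1
        · field_simp
          ring
        · norm_num
      push_cast
      exact ⟨l4', l5'⟩
  obtain ⟨j, r, hr, rfl⟩ : ∃ j r, r < 3 ∧ i = 3 * j + 1 + r :=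
    ⟨(i - 1) / 3, (i - 1) % 3, by lia, by lia⟩
  obtain ⟨l1, l2⟩ := main j
  have hj := inv_ne_zero (Nat.cast_add_one_ne_zero (R := K) j)
  interval_cases r
  · exact l1.ne_zero hs hj
  · exact l2.ne_zero hs (neg_ne_zero.2 hj)
  · exact (third j l1 l2).ne_zero hs (coeff_ne j)

end Lead

section Fibre

variable {K R : Type*} [Field K] [CommRing R] [Algebra K R] {α β : K} {t m l : R} {T : ℕ → R}
  {δ : Derivation K R R}

theorem IsHamiltonian.cubicInv (hδ : IsHamiltonian (algebraMap K R α) (algebraMap K R β) t m l δ) :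
    δ (cubicInv (algebraMap K R α) (algebraMap K R β) t m l) = 0 := by
  simp only [CubicGrowth.cubicInv, map_sub, map_add, Derivation.leibniz, Derivation.leibniz_pow,
    hδ.map_t, hδ.map_al, hδ.map_be, hδ.map_m, hδ.map_l, smul_eq_mul]
  simp only [nsmul_eq_mul]
  ring

theorem eval_scaleRoots_map [Nontrivial R] {S : Type*} [CommRing S] [Algebra K S] (φ : R →ₐ[K] S)
    (P : Polynomial K) (x y : R) (s : S) (h : φ x = φ y * s) :
    φ (((P.map (algebraMap K R)).scaleRoots y).eval x) =
      φ y ^ P.natDegree * Polynomial.aeval s P := by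
  have key := Polynomial.scaleRoots_eval₂_mul (p := P.map (algebraMap K R)) (φ : R →+* S) s y
  have h' : (φ : R →+* S) y * s = (φ : R →+* S) x := h.symm
  rw [Polynomial.natDegree_map, Polynomial.eval₂_map, h', Polynomial.eval₂_hom,
    φ.comp_algebraMap] at key
  exact key

variable [IsDomain R] [CharZero K] [WfDvdMonoid R]

/-- The prime factors of the tau functions do not divide first integrals of the flow. -/
theorem IsTau.not_dvd_of_derivation_eq_zero
    (h : IsTau (algebraMap K R α) (algebraMap K R β) t m l T) (hα : α ≠ 0)
    (hδ : IsHamiltonian (algebraMap K R α) (algebraMap K R β) t m l δ) {q : R} (hq : Prime q)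
    {n : ℕ} (hqT : q ∣ T (n + 5)) {f : R} (hf : f ≠ 0) (hδf : δ f = 0) : ¬ q ∣ f := by
  have key : ¬ q ∣ δ (T (n + 5)) :=
    h.not_dvd_derivation (δ := δ.restrictScalars ℤ) (hα.isUnit.map (algebraMap K R)) hδ hq hqT
  intro hqf
  obtain ⟨N, g, hg, rfl⟩ := WfDvdMonoid.max_power_factor hf hq.irreducible
  obtain _ | N := N
  · exact hg (by simpa using hqf)
  rw [Derivation.leibniz, Derivation.leibniz_pow, Nat.add_sub_cancel] at hδf
  have e : q ^ N * (((N + 1 : ℕ) : R) * δ q * g + q * δ g) = 0 := by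
    simp only [smul_eq_mul, nsmul_eq_mul] at hδf
    linear_combination hδf
  have e' := (mul_eq_zero.1 e).resolve_left (pow_ne_zero _ hq.ne_zero)
  have hN : IsUnit ((N + 1 : ℕ) : R) := by
    have : IsUnit ((N + 1 : ℕ) : K) := (Nat.cast_ne_zero.2 (Nat.succ_ne_zero N)).isUnit
    simpa using this.map (algebraMap K R)
  have hd : q ∣ ((N + 1 : ℕ) : R) * δ q * g :=
    (dvd_add_left (dvd_mul_right q (δ g))).1 (e' ▸ dvd_zero q)
  have hqδ : q ∣ δ q := by
    rcases hq.dvd_or_dvd hd with h1 | h1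
    · exact (hq.dvd_or_dvd h1).resolve_left fun h2 => hq.not_isUnit (isUnit_of_dvd_unit h2 hN)
    · exact absurd h1 hg
  obtain ⟨r, hr⟩ := hqT
  apply key
  rw [hr, Derivation.leibniz]
  exact dvd_add (dvd_mul_right _ _) (hqδ.mul_left _)

/-- The value of the invariant on a fibre component is transcendental. -/
theorem IsTau.transcendental (h : IsTau (algebraMap K R α) (algebraMap K R β) t m l T)
    (hα : α ≠ 0) (hδ : IsHamiltonian (algebraMap K R α) (algebraMap K R β) t m l δ)
    (ρ : R →ₐ[K] Polynomial K) (hρt : ρ t = 1) (hρm : ρ m = 0) (hρl : ρ l = Polynomial.X)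
    {κ : Type*} [Field κ] [Algebra K κ] (π : R →ₐ[K] κ) {q : R} (hq : Prime q)
    (hπ : ∀ r, π r = 0 → q ∣ r) {n : ℕ} (hqT : q ∣ T (n + 5)) :
    Transcendental K
      (-π (cubicInv (algebraMap K R α) (algebraMap K R β) t m l) /
        (algebraMap K κ α * π t ^ 3)) := by
  set H := cubicInv (algebraMap K R α) (algebraMap K R β) t m l with hH
  have hα' : algebraMap K κ α ≠ 0 := by simpa using hα
  have ht : π t ≠ 0 := fun h0 => isRelPrime_of_dvd_prime hq hqT (h.prime_t _ (by lia)) (hπ _ h0)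
  refine transcendental_iff.2 fun P hP => ?_
  by_contra hP0
  set y := algebraMap K R α * t ^ 3 with hy
  have e := eval_scaleRoots_map π P (-H) y
    (-π H / (algebraMap K κ α * π t ^ 3)) (by simp [hy]; field_simp)
  have e' := eval_scaleRoots_map ρ P (-H) y Polynomial.X
    (by simp [hy, hH, CubicGrowth.cubicInv, hρt, hρm, hρl])
  rw [hP, mul_zero] at e
  refine h.not_dvd_of_derivation_eq_zero hα hδ hq hqT (fun h0 => ?_) ?_ (hπ _ e)
  · rw [h0, map_zero, Polynomial.aeval_X_left_apply] at e'
    refine mul_ne_zero (pow_ne_zero _ ?_) hP0 e'.symm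
    simpa [hy, hρt] using hα
  · rw [Polynomial.eval_eq_sum_range, map_sum]
    refine Finset.sum_eq_zero fun i _ => ?_
    simp [hy, Derivation.leibniz, Derivation.leibniz_pow, hδ.map_t, hδ.cubicInv, hH]

theorem IsTau.map_ne_zero (h : IsTau (algebraMap K R α) (algebraMap K R β) t m l T)
    (hα : α ≠ 0) (hδ : IsHamiltonian (algebraMap K R α) (algebraMap K R β) t m l δ)
    (ρ : R →ₐ[K] Polynomial K) (hρt : ρ t = 1) (hρm : ρ m = 0) (hρl : ρ l = Polynomial.X)
    {κ : Type*} [Field κ] [Algebra K κ] (π : R →ₐ[K] κ) {q : R} (hq : Prime q)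
    (hπ : ∀ r, π r = 0 ↔ q ∣ r) {n : ℕ} (hqT : q ∣ T (n + 5)) {k : ℕ} (hk : n + 5 < k) :
    π (T k) ≠ 0 := by
  have hs := h.transcendental hα hδ ρ hρt hρm hρl π hq (fun r => (hπ r).1) hqT
  set H := cubicInv (algebraMap K R α) (algebraMap K R β) t m l with hH
  have hα' : algebraMap K κ α ≠ 0 := by simpa using hα
  have ht : π t ≠ 0 := fun h0 =>
    isRelPrime_of_dvd_prime hq hqT (h.prime_t _ (by lia)) ((hπ _).1 h0)
  have hwin : ∀ i, n + 5 < i → i < n + 10 → π (T i) ≠ 0 := fun i hi hi' h0 =>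
    isRelPrime_of_dvd_prime hq hqT (h.pair _ _ (by lia) hi (by lia)) ((hπ _).1 h0)
  have h0 : π (T (n + 5)) = 0 := (hπ _).2 hqT
  have h6 := hwin (n + 6) (by lia) (by lia)
  have h7 := hwin (n + 7) (by lia) (by lia)
  have h8 := hwin (n + 8) (by lia) (by lia)
  have h9 := hwin (n + 9) (by lia) (by lia)
  obtain ⟨w, hw⟩ : ∃ w : ℕ → κ, ∀ j, w j = π (T (j + 8)) * π (T (j + 5)) /
    (π t * π (T (j + 7)) * π (T (j + 6))) := ⟨_, fun _ => rfl⟩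
  have hw1 : w (n + 1) = -π H / (algebraMap K κ α * π t ^ 3) := by
    have e := congrArg π (h.rel (n + 5))
    simp only [hw, add_assoc, Nat.reduceAdd, map_mul, map_add, map_neg, map_pow, h0,
      AlgHom.commutes, ← hH] at e ⊢
    field_simp
    linear_combination e
  have hw2 : w (n + 2) = algebraMap K κ β - w (n + 1) + algebraMap K κ α * (w (n + 1))⁻¹ := by
    have e := congrArg π (h.additive (n + 4))
    simp only [hw, add_assoc, Nat.reduceAdd, map_mul, map_add, map_pow, h0,
      AlgHom.commutes] at e ⊢
    field_simp
    linear_combination e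
  have hrec : ∀ j, w (j + 1) ≠ 0 → w (j + 2) * (w (j + 1) * w j) = algebraMap K κ α *
      (-π H / (algebraMap K κ α * π t ^ 3) - w (j + 1)) := by
    intro j hne
    have e := congrArg π (h.rel (j + 5))
    simp only [hw, ne_eq, div_eq_zero_iff, mul_eq_zero, not_or] at hne
    obtain ⟨⟨a1, a2⟩, ⟨a3, a4⟩, a5⟩ := hne
    simp only [hw, add_assoc, Nat.reduceAdd, map_mul, map_add, map_neg, map_pow,
      AlgHom.commutes, ← hH] at e a1 a2 a3 a4 a5 ⊢
    field_simp
    linear_combination e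
  have hv := ne_zero_of_recursion hs hα (v := fun i => w (n + i)) hw1 (hw1 ▸ hw2)
    (fun i _ => hrec (n + i)) (k - (n + 5)) (by lia)
  have hk' : n + (k - (n + 5)) + 5 = k := by lia
  rw [hw, hk'] at hv
  exact fun h1 => hv (by rw [h1, mul_zero, zero_div])

/-- Distinct tau functions have no common prime factor. -/
theorem IsTau.not_dvd_of_dvd (h : IsTau (algebraMap K R α) (algebraMap K R β) t m l T)
    (hα : α ≠ 0) (hδ : IsHamiltonian (algebraMap K R α) (algebraMap K R β) t m l δ)
    (ρ : R →ₐ[K] Polynomial K) (hρt : ρ t = 1) (hρm : ρ m = 0) (hρl : ρ l = Polynomial.X)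
    {q : R} (hq : Prime q) {n : ℕ} (hqT : q ∣ T (n + 5)) {k : ℕ} (hk : n + 5 < k) :
    ¬ q ∣ T k := by
  have hI : (Ideal.span {q}).IsPrime := (Ideal.span_singleton_prime hq.ne_zero).2 hq
  let κ := FractionRing (R ⧸ Ideal.span {q})
  let π : R →ₐ[K] κ := (IsScalarTower.toAlgHom K (R ⧸ Ideal.span {q}) κ).comp
    (Ideal.Quotient.mkₐ K (Ideal.span {q}))
  have hπ : ∀ r, π r = 0 ↔ q ∣ r := fun r => by
    rw [← Ideal.mem_span_singleton, ← Ideal.Quotient.eq_zero_iff_mem]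
    exact map_eq_zero_iff _ (IsFractionRing.injective (R ⧸ Ideal.span {q}) κ)
  exact fun h1 => h.map_ne_zero hα hδ ρ hρt hρm hρl π hq hπ hqT hk ((hπ _).2 h1)

end Fibre

section Numerators

variable {R : Type*} [CommRing R] {a b c d d' t z m l al be : R} {T : ℕ → R}

/-- The numerators of the coordinates of the iterates; `d'` stands for the inverse of `d`. -/
def numer (c d' t z : R) (T : ℕ → R) : ℕ → R
  | 0 => z
  | j + 1 => d' * ((∏ i ∈ Finset.range j, T (i + 2)) * T (j + 4) * T (j + 1)
      - c * t * ∏ i ∈ Finset.range (j + 2), T (i + 2)) - T (j + 3) * numer c d' t z T j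

theorem mul_numer_succ (hd : d * d' = 1) (j : ℕ) :
    d * numer c d' t z T (j + 1) = (∏ i ∈ Finset.range j, T (i + 2)) * T (j + 4) * T (j + 1)
      - c * t * ∏ i ∈ Finset.range (j + 2), T (i + 2) - d * T (j + 3) * numer c d' t z T j := by
  rw [numer]
  linear_combination ((∏ i ∈ Finset.range j, T (i + 2)) * T (j + 4) * T (j + 1)
      - c * t * ∏ i ∈ Finset.range (j + 2), T (i + 2)) * hd

/-- The common factor cancelled at the `n`-th step. -/
def cancelled (T : ℕ → R) (n : ℕ) : R := (∏ i ∈ Finset.range (n + 1), T (i + 2)) * T (n + 2)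

/-- The reduced iterates. -/
def reduced (c d' t z : R) (T : ℕ → R) (n : ℕ) : Fin 4 → R :=
  ![numer c d' t z T (n + 2), numer c d' t z T (n + 1) * T (n + 4),
    numer c d' t z T n * T (n + 3) * T (n + 4), t * ∏ i ∈ Finset.range (n + 3), T (i + 2)]

theorem linear_reduced (hd : d * d' = 1) (n : ℕ) :
    c * reduced c d' t z T n 3 + d * (reduced c d' t z T n 0 + reduced c d' t z T n 1)
      = cancelled T n * T (n + 5) := by
  have := mul_numer_succ (c := c) (t := t) (z := z) (T := T) hd (n + 1)
  simp only [add_assoc, Nat.reduceAdd] at this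
  simp only [reduced, cancelled, Matrix.cons_val]
  linear_combination this

theorem IsTau.map_reduced [IsDomain R] (h : IsTau (b * c - c ^ 2 - a * d) (4 * c - b) t m l T)
    (hd : d * d' = 1) (n : ℕ) {x y w s : R} (hx : reduced c d' t z T n 0 = x)
    (hy : reduced c d' t z T n 1 = y) (hw : reduced c d' t z T n 2 = w)
    (hs : reduced c d' t z T n 3 = s) :
    -a * s ^ 2 - b * (x + y) * s - c * (x + y + w) * s - d * (x + y) * (2 * x + 2 * y + w)
      = cancelled T n * reduced c d' t z T (n + 1) 0 ∧
    x * (c * s + d * (x + y)) = cancelled T n * reduced c d' t z T (n + 1) 1 ∧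
    y * (c * s + d * (x + y)) = cancelled T n * reduced c d' t z T (n + 1) 2 ∧
    s * (c * s + d * (x + y)) = cancelled T n * reduced c d' t z T (n + 1) 3 := by
  have hL := linear_reduced (c := c) (t := t) (z := z) (T := T) hd n
  rw [hs, hx, hy] at hL
  refine ⟨?_, ?_, ?_, ?_⟩
  · have hd0 : d ≠ 0 := fun h0 => by simp [h0] at hd
    refine mul_left_cancel₀ hd0 ?_
    have h1 := mul_numer_succ (c := c) (t := t) (z := z) (T := T) hd n
    have h3 := mul_numer_succ (c := c) (t := t) (z := z) (T := T) hd (n + 2)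
    have ha := h.additive n
    simp only [reduced, cancelled, add_assoc, Nat.reduceAdd, Finset.prod_range_succ,
      Matrix.cons_val] at hx hy hw hs hL h1 h3 ⊢
    generalize numer c d' t z T (n + 3) = M3 at *
    generalize ∏ i ∈ Finset.range n, T (i + 2) = E at *
    subst hw hs
    rw [hx] at h3
    have hyw : d * (y + numer c d' t z T n * T (n + 3) * T (n + 4))
        = E * T (n + 4) ^ 2 * T (n + 1) - c * (t * (E * T (n + 2) * T (n + 3) * T (n + 4))) := by
      rw [← hy]; linear_combination T (n + 4) * h1
    generalize numer c d' t z T n * T (n + 3) * T (n + 4) = w at *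
    linear_combination
      (-b * (t * (E * T (n + 2) * T (n + 3) * T (n + 4))) - d * (x + y)
        - (E * T (n + 2) * T (n + 2) * T (n + 5)
          - c * (t * (E * T (n + 2) * T (n + 3) * T (n + 4))))
        - d * x - d * (y + w)) * hL
      - E * T (n + 2) * T (n + 2) * T (n + 5) * hyw - E * T (n + 2) * T (n + 2) * h3
      - E ^ 2 * T (n + 2) ^ 2 * ha
  · rw [hL, ← hx]; simp only [reduced, add_assoc, Nat.reduceAdd, Matrix.cons_val]; ring
  · rw [hL, ← hy]; simp only [reduced, add_assoc, Nat.reduceAdd, Matrix.cons_val]; ring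
  · rw [hL, ← hs]
    simp only [reduced, add_assoc, Nat.reduceAdd, Matrix.cons_val, Finset.prod_range_succ]; ring

/-- After a fibre component carrying a prime `q` has been crossed, `q` divides no numerator. -/
theorem IsTau.not_dvd_numer [IsDomain R] (h : IsTau al be t m l T) (hd : d * d' = 1) {q : R}
    (hq : Prime q) (hq2 : ¬ q ∣ 2) {k : ℕ} (hqT : q ∣ T (k + 5))
    (hfar : ∀ i, 2 ≤ i → i ≠ k + 5 → ¬ q ∣ T i) (j : ℕ) (hj : k + 3 ≤ j) :
    ¬ q ∣ numer c d' t z T j := by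
  have hprod : ∀ {j}, k + 4 ≤ j → q ∣ ∏ i ∈ Finset.range j, T (i + 2) := fun {j} hj =>
    hqT.trans (Finset.dvd_prod_of_mem (fun i => T (i + 2))
      (Finset.mem_range.2 (by lia : k + 3 < j)))
  have hE : ¬ q ∣ ∏ i ∈ Finset.range (k + 2), T (i + 2) :=
    hq.not_dvd_finsetProd fun i hi =>
      hfar _ (by lia) (by have := Finset.mem_range.1 hi; lia)
  have h3 : ¬ q ∣ T (k + 3) := hfar _ (by lia) (by lia)
  have h6 : ¬ q ∣ T (k + 6) := hfar _ (by lia) (by lia)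
  have m3 := mul_numer_succ (c := c) (t := t) (z := z) (T := T) hd (k + 2)
  have m4 := mul_numer_succ (c := c) (t := t) (z := z) (T := T) hd (k + 3)
  have ha := h.additive (k + 1)
  have step : ∀ j, k + 4 ≤ j → ¬ q ∣ numer c d' t z T j → ¬ q ∣ numer c d' t z T (j + 1) := by
    intro j hj hj0 hdvd
    have e := mul_numer_succ (c := c) (t := t) (z := z) (T := T) hd j
    have e1 : q ∣ T (j + 3) * numer c d' t z T j := by
      have e2 : T (j + 3) * numer c d' t z T j = d' * ((∏ i ∈ Finset.range j, T (i + 2)) *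
          (T (j + 4) * T (j + 1)) - (∏ i ∈ Finset.range (j + 2), T (i + 2)) * (c * t))
          - numer c d' t z T (j + 1) := by
        linear_combination d' * e
          + (-T (j + 3) * numer c d' t z T j - numer c d' t z T (j + 1)) * hd
      rw [e2]
      exact dvd_sub ((dvd_sub ((hprod hj).mul_right _)
        ((hprod (by lia)).mul_right _)).mul_left _) hdvd
    exact hq.not_dvd_mul (hfar _ (by lia) (by lia)) hj0 e1
  simp only [add_assoc, Nat.reduceAdd, Finset.prod_range_succ _ (k + 2),
    Finset.prod_range_succ _ (k + 3), Finset.prod_range_succ _ (k + 4)] at m3 m4 ha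
  generalize ∏ i ∈ Finset.range (k + 2), T (i + 2) = E at *
  obtain ⟨r, hr⟩ := hqT
  have b3 : ¬ q ∣ numer c d' t z T (k + 3) := by
    intro hdvd
    have e : q ∣ E * (T (k + 6) * T (k + 3)) := by
      have e2 : E * (T (k + 6) * T (k + 3)) = d * numer c d' t z T (k + 3)
          + q * (r * (d * numer c d' t z T (k + 2))) + q * (r * (c * t * E * T (k + 4))) := by
        linear_combination -m3
          + (c * t * E * T (k + 4) + d * numer c d' t z T (k + 2)) * hr
      rw [e2]
      exact dvd_add (dvd_add (hdvd.mul_left _) (dvd_mul_right _ _)) (dvd_mul_right _ _)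
    exact hq.not_dvd_mul hE (hq.not_dvd_mul h6 h3) e
  have b4 : ¬ q ∣ numer c d' t z T (k + 4) := by
    intro hdvd
    have e : q ∣ 2 * (E * (T (k + 6) ^ 2 * T (k + 3) ^ 2)) := by
      have e2 : 2 * (E * (T (k + 6) ^ 2 * T (k + 3) ^ 2)) =
          -(d * T (k + 3)) * numer c d' t z T (k + 4)
          + q * (r * (E * (be * t * T (k + 3) * T (k + 4)
            * T (k + 6) + al * t ^ 2 * T (k + 5) * T (k + 4) ^ 2
            - T (k + 5) * T (k + 6) * T (k + 2))
            + T (k + 6) * T (k + 3) * (d * numer c d' t z T (k + 2)))) := by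
        linear_combination T (k + 3) * m4 + E * ha - T (k + 6) * T (k + 3) * m3
          + (E * (be * t * T (k + 3) * T (k + 4)
            * T (k + 6) + al * t ^ 2 * T (k + 5) * T (k + 4) ^ 2
            - T (k + 5) * T (k + 6) * T (k + 2))
            + T (k + 6) * T (k + 3) * (d * numer c d' t z T (k + 2))) * hr
      rw [e2]
      exact dvd_add (hdvd.mul_left _) (dvd_mul_right _ _)
    exact hq.not_dvd_mul hq2 (hq.not_dvd_mul hE (hq.not_dvd_mul (mt hq.dvd_of_dvd_pow h6)
      (mt hq.dvd_of_dvd_pow h3))) e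
  obtain rfl | hj := hj.eq_or_lt
  · exact b3
  induction j, hj using Nat.le_induction with
  | base => exact b4
  | succ j hj' ih => exact step j hj' (ih (by lia))

/-- The reduced iterates have no common prime factor. -/
theorem IsTau.not_forall_dvd_reduced [IsDomain R] (h : IsTau al be t m l T) (hd : d * d' = 1)
    {q : R} (hq : Prime q) (hq2 : ¬ q ∣ 2)
    (hfar : ∀ k, q ∣ T (k + 5) → ∀ i, 2 ≤ i → i ≠ k + 5 → ¬ q ∣ T i) (n : ℕ) :
    ¬ ∀ i, q ∣ reduced c d' t z T n i := by
  intro hall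
  have h0 : q ∣ numer c d' t z T (n + 2) := hall 0
  have h1 : q ∣ numer c d' t z T (n + 1) * T (n + 4) := hall 1
  have h3 : q ∣ t * ∏ i ∈ Finset.range (n + 3), T (i + 2) := hall 3
  rcases hq.dvd_or_dvd h3 with h3 | h3
  · have hT : ∀ i, 1 ≤ i → ¬ q ∣ T i := fun i hi =>
      isRelPrime_of_dvd_prime hq h3 (h.prime_t i hi).symm
    have e := linear_reduced (c := c) (t := t) (z := z) (T := T) hd n
    have e1 : q ∣ cancelled T n * T (n + 5) := by
      rw [← e]
      exact dvd_add ((hall 3).mul_left _) ((dvd_add (hall 0) (hall 1)).mul_left _)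
    exact hq.not_dvd_mul (hq.not_dvd_mul (hq.not_dvd_finsetProd fun i _ => hT _ (by lia))
      (hT _ (by lia))) (hT _ (by lia)) e1
  · obtain ⟨i, hi, hqi⟩ := (hq.dvd_finsetProd_iff _).1 h3
    have hi' := Finset.mem_range.1 hi
    obtain hi2 | hi3 := lt_or_ge i 3
    · interval_cases i
      · exact hq.not_dvd_one (h.two ▸ hqi)
      · exact hq.not_dvd_one (h.three ▸ hqi)
      · exact hq.not_dvd_one (h.four ▸ hqi)
    · obtain ⟨k, rfl⟩ := Nat.exists_eq_add_of_le' hi3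
      exact h.not_dvd_numer hd hq hq2 hqi (hfar k hqi) _ (by lia) h0

end Numerators

section Degrees

/-- The degree of the `n`-th tau function. -/
def tauDeg : ℕ → ℕ
  | 0 => 2
  | 1 => 1
  | 2 => 0
  | n + 3 => n * n / 4

theorem tauDeg_add_left (n : ℕ) :
    tauDeg (n + 5) + tauDeg n = 2 + tauDeg (n + 4) + tauDeg (n + 1) := by
  obtain _ | _ | _ | n := n
  · rfl
  · rfl
  · rfl
  · simp only [tauDeg, add_assoc]
    obtain ⟨k, rfl | rfl⟩ := n.even_or_odd'
    · ring_nf; lia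
    · ring_nf; lia

theorem tauDeg_add_right (n : ℕ) :
    tauDeg (n + 5) + tauDeg n = 3 + tauDeg (n + 3) + tauDeg (n + 2) := by
  obtain _ | _ | _ | n := n
  · rfl
  · rfl
  · rfl
  · simp only [tauDeg, add_assoc]
    obtain ⟨k, rfl | rfl⟩ := n.even_or_odd'
    · ring_nf; lia
    · ring_nf; lia

theorem tauDeg_numer (n : ℕ) :
    tauDeg (n + 4) + tauDeg (n + 1) = 1 + tauDeg (n + 2) + tauDeg (n + 3) := by
  obtain _ | _ | n := n
  · rfl
  · rfl
  · simp only [tauDeg, add_assoc]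
    obtain ⟨k, rfl | rfl⟩ := n.even_or_odd'
    · ring_nf; lia
    · ring_nf; lia

variable {K σ : Type*} [Field K]

theorem isHomogeneous_of_mul {p q : MvPolynomial σ K} {m k : ℕ} (hp : p.IsHomogeneous m)
    (hp0 : p ≠ 0) (hpq : (p * q).IsHomogeneous (m + k)) : q.IsHomogeneous k := by
  let _ : GradedAlgebra (homogeneousSubmodule σ K) := gradedAlgebra
  have h1 := DirectSum.coe_decompose_mul_add_of_left_mem (homogeneousSubmodule σ K) (j := k)
    (b := q) hp
  rw [DirectSum.decompose_of_mem_same _ hpq] at h1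
  have h2 := mul_left_cancel₀ hp0 h1
  rw [h2]
  exact (DirectSum.decompose (homogeneousSubmodule σ K) q k).2

variable {al be t m l c d' z : MvPolynomial σ K} {T : ℕ → MvPolynomial σ K}

theorem IsTau.isHomogeneous (h : IsTau al be t m l T) (h0 : T 0 ≠ 0)
    (hal : al.IsHomogeneous 0) (hbe : be.IsHomogeneous 0) (ht : t.IsHomogeneous 1)
    (hm : m.IsHomogeneous 1) (hl : l.IsHomogeneous 1) (hT0 : (T 0).IsHomogeneous 2) (n : ℕ) :
    (T n).IsHomogeneous (tauDeg n) := by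
  have hA : (-(al * t ^ 2)).IsHomogeneous 2 := by simpa using (hal.mul (ht.pow 2)).neg
  have hB : (-cubicInv al be t m l).IsHomogeneous 3 := by
    refine IsHomogeneous.neg (((hl.mul hm).mul ((hl.add hm).sub ?_)).sub ?_)
    · simpa using hbe.mul ht
    · simpa using (hal.mul (ht.pow 2)).mul (hl.add hm)
  induction n using Nat.strong_induction_on with
  | _ n ih =>
    match n, ih with
    | 0, _ => exact hT0
    | 1, _ => rw [h.one]; exact hm
    | 2, _ => rw [h.two]; exact isHomogeneous_one _ _
    | 3, _ => rw [h.three]; exact isHomogeneous_one _ _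
    | 4, _ => rw [h.four]; exact isHomogeneous_one _ _
    | n + 5, ih =>
      have hn : T n ≠ 0 := by
        obtain rfl | hn := n.eq_zero_or_pos
        · exact h0
        · exact h.ne_zero n hn
      refine isHomogeneous_of_mul (ih n (by lia)) hn ?_
      rw [mul_comm, h.rel, add_comm (tauDeg n)]
      refine IsHomogeneous.add ?_ ?_
      · rw [tauDeg_add_left]
        exact (hA.mul (ih _ (by lia))).mul (ih _ (by lia))
      · rw [tauDeg_add_right]
        exact (hB.mul (ih _ (by lia))).mul (ih _ (by lia))

theorem isHomogeneous_numer (hT : ∀ n, (T n).IsHomogeneous (tauDeg n))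
    (hc : c.IsHomogeneous 0) (hd' : d'.IsHomogeneous 0) (ht : t.IsHomogeneous 1)
    (hz : z.IsHomogeneous 1) (j : ℕ) :
    (numer c d' t z T j).IsHomogeneous (1 + ∑ i ∈ Finset.range (j + 1), tauDeg (i + 2)) := by
  have hE : ∀ j, (∏ i ∈ Finset.range j, T (i + 2)).IsHomogeneous
      (∑ i ∈ Finset.range j, tauDeg (i + 2)) := fun j => IsHomogeneous.prod _ _ _ fun i _ => hT _
  induction j with
  | zero => simpa [tauDeg, numer] using hz
  | succ j ih =>
    rw [numer]
    have e : 1 + ∑ i ∈ Finset.range (j + 1 + 1), tauDeg (i + 2)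
        = 0 + (∑ i ∈ Finset.range j, tauDeg (i + 2) + tauDeg (j + 4) + tauDeg (j + 1)) := by
      rw [Finset.sum_range_succ, Finset.sum_range_succ, zero_add, add_assoc, add_assoc,
        add_assoc, tauDeg_numer]
      simp only [add_assoc, Nat.reduceAdd]
      ring
    refine IsHomogeneous.sub ?_ ?_
    · rw [e]
      refine hd'.mul ((((hE j).mul (hT _)).mul (hT _)).sub ?_)
      rw [← zero_add (_ + _ + _), ← e]
      simpa using (hc.mul ht).mul (hE (j + 2))
    · rw [Finset.sum_range_succ, add_comm _ (tauDeg _), add_left_comm]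
      exact (hT (j + 3)).mul ih

theorem isHomogeneous_reduced (hT : ∀ n, (T n).IsHomogeneous (tauDeg n))
    (hc : c.IsHomogeneous 0) (hd' : d'.IsHomogeneous 0) (ht : t.IsHomogeneous 1)
    (hz : z.IsHomogeneous 1) (n : ℕ) (i : Fin 4) :
    (reduced c d' t z T n i).IsHomogeneous
      (1 + ∑ i ∈ Finset.range (n + 3), tauDeg (i + 2)) := by
  have hM := isHomogeneous_numer hT hc hd' ht hz
  fin_cases i
  · exact hM _
  · rw [Finset.sum_range_succ, ← add_assoc]
    exact (hM _).mul (hT _)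
  · rw [Finset.sum_range_succ, Finset.sum_range_succ, ← add_assoc, ← add_assoc]
    exact ((hM _).mul (hT _)).mul (hT _)
  · exact ht.mul (IsHomogeneous.prod _ _ _ fun i _ => hT _)

theorem one_add_sum_tauDeg (n : ℕ) :
    ((1 + ∑ i ∈ Finset.range (n + 3), tauDeg (i + 2) : ℕ) : ℚ) =
      17 / 16 + (5 / 12) * n + (3 / 8) * n ^ 2 + (1 / 12) * n ^ 3 - (1 / 16) * (-1) ^ n := by
  have hg : ∀ n : ℕ, (tauDeg (n + 5) : ℚ) = (n + 2) ^ 2 / 4 - 1 / 8 + (-1) ^ n / 8 := by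
    intro n
    simp only [tauDeg]
    obtain ⟨k, rfl | rfl⟩ := n.even_or_odd'
    · rw [show (2 * k + 2) * (2 * k + 2) / 4 = (k + 1) ^ 2 by ring_nf; lia, pow_mul]
      push_cast
      norm_num
      ring
    · rw [show (2 * k + 1 + 2) * (2 * k + 1 + 2) / 4 = k ^ 2 + 3 * k + 2 by ring_nf; lia,
        pow_succ (-1 : ℚ), pow_mul]
      push_cast
      norm_num
      ring
  induction n with
  | zero => simp [Finset.sum_range_succ, tauDeg]; norm_num
  | succ n ih =>
    rw [show n + 1 + 3 = n + 3 + 1 by rfl, Finset.sum_range_succ, ← add_assoc, Nat.cast_add, ih,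
      show n + 3 + 2 = n + 5 by rfl, hg]
    push_cast
    ring

theorem tendsto_log_div_of_le_pow {d : ℕ → ℕ} (k : ℕ) (hd : ∀ n, d n ≤ (n + 1) ^ k) :
    Filter.Tendsto (fun n : ℕ => Real.log (d n) / n) Filter.atTop (nhds 0) := by
  have h1 : Filter.Tendsto (fun n : ℕ => k * (Real.log (n + 1 : ℝ) / (n : ℝ))) Filter.atTop
      (nhds 0) := by
    have h2 := ((Real.tendsto_pow_log_div_mul_add_atTop 1 (-1) 1 one_ne_zero).comp
      (tendsto_natCast_atTop_atTop.comp (Filter.tendsto_add_atTop_nat 1))).const_mul (k : ℝ)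
    rw [mul_zero] at h2
    refine h2.congr fun n => ?_
    simp
  refine tendsto_of_tendsto_of_tendsto_of_le_of_le tendsto_const_nhds h1 (fun n => ?_) fun n => ?_
  · exact div_nonneg (Real.log_natCast_nonneg _) n.cast_nonneg
  · rw [← mul_div_assoc]
    refine div_le_div_of_nonneg_right ?_ n.cast_nonneg
    obtain h0 | h0 := (d n).eq_zero_or_pos
    · have := Real.log_natCast_nonneg (n + 1)
      push_cast at this
      rw [h0, Nat.cast_zero, Real.log_zero]
      positivity
    · rw [← Real.log_pow]
      exact Real.log_le_log (by exact_mod_cast h0) (by exact_mod_cast hd n)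

theorem one_add_sum_tauDeg_le (n : ℕ) :
    1 + ∑ i ∈ Finset.range (n + 3), tauDeg (i + 2) ≤ (n + 1) ^ 3 := by
  have h := one_add_sum_tauDeg n
  suffices ((1 + ∑ i ∈ Finset.range (n + 3), tauDeg (i + 2) : ℕ) : ℚ) ≤ ((n + 1) ^ 3 : ℕ) by
    exact_mod_cast this
  rw [h]
  have h1 : (-1 : ℚ) ≤ (-1) ^ n := by
    obtain h | h := neg_one_pow_eq_or ℚ n <;> rw [h]
    norm_num
  push_cast
  obtain rfl | hn := n.eq_zero_or_pos
  · norm_num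
  · have h2 : (1 : ℚ) ≤ n := by exact_mod_cast hn
    nlinarith [pow_le_pow_left₀ zero_le_one h2 3, pow_le_pow_left₀ zero_le_one h2 2]

end Degrees

section Linear

variable {K : Type*} [Field K] {c d : K}

/-- The linear form whose quotient by `X 3` is the second chart coordinate. -/
noncomputable def formL (c d : K) : MvPolynomial (Fin 4) K := C c * X 3 + C d * (X 0 + X 1)

/-- The linear form whose quotient by `X 3` is the first chart coordinate. -/
noncomputable def formM (c d : K) : MvPolynomial (Fin 4) K := C c * X 3 + C d * (X 1 + X 2)

theorem isHomogeneous_formL (c d : K) : (formL c d).IsHomogeneous 1 :=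
  ((isHomogeneous_X K 3).C_mul c).add (((isHomogeneous_X K 0).add (isHomogeneous_X K 1)).C_mul d)

theorem isHomogeneous_formM (c d : K) : (formM c d).IsHomogeneous 1 :=
  ((isHomogeneous_X K 3).C_mul c).add (((isHomogeneous_X K 1).add (isHomogeneous_X K 2)).C_mul d)

theorem exists_algHom_forms (hd : d ≠ 0) {S : Type*} [CommRing S] [Algebra K S] (t m l : S) :
    ∃ ρ : MvPolynomial (Fin 4) K →ₐ[K] S,
      ρ (X 3) = t ∧ ρ (formM c d) = m ∧ ρ (formL c d) = l := by
  have h : algebraMap K S d * algebraMap K S d⁻¹ = 1 := by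
    rw [← map_mul, mul_inv_cancel₀ hd, map_one]
  refine ⟨MvPolynomial.aeval ![algebraMap K S d⁻¹ * (l - algebraMap K S c * t), 0,
    algebraMap K S d⁻¹ * (m - algebraMap K S c * t), t], ?_, ?_, ?_⟩
  · simp
  · simp only [formM, map_add, map_mul, MvPolynomial.aeval_X, ← MvPolynomial.algebraMap_eq,
      AlgHom.commutes, Matrix.cons_val]
    linear_combination (m - algebraMap K S c * t) * h
  · simp only [formL, map_add, map_mul, MvPolynomial.aeval_X, ← MvPolynomial.algebraMap_eq,
      AlgHom.commutes, Matrix.cons_val]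
    linear_combination (l - algebraMap K S c * t) * h

theorem irreducible_of_isHomogeneous_one {σ : Type*} {p : MvPolynomial σ K}
    (hp : p.IsHomogeneous 1) (hp0 : p ≠ 0) : Irreducible p := by
  refine irreducible_of_totalDegree_eq_one (hp.totalDegree hp0) fun x hx => ?_
  obtain ⟨i, hi⟩ := ne_zero_iff.1 hp0
  exact isUnit_iff_ne_zero.2 (ne_zero_of_dvd_ne_zero hi (hx i))

theorem isRelPrime_of_map {σ S : Type*} [CommRing S] [Algebra K S] {p q : MvPolynomial σ K}
    (hp : p.IsHomogeneous 1) (hp0 : p ≠ 0) (ρ : MvPolynomial σ K →ₐ[K] S) (h0 : ρ p = 0)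
    (h1 : ρ q ≠ 0) : IsRelPrime p q := by
  refine (irreducible_of_isHomogeneous_one hp hp0).isRelPrime_iff_not_dvd.2 fun h => h1 ?_
  obtain ⟨r, rfl⟩ := h
  rw [map_mul, h0, zero_mul]

theorem exists_isHamiltonian (hd : d ≠ 0) (α β : K) :
    ∃ δ : Derivation K (MvPolynomial (Fin 4) K) (MvPolynomial (Fin 4) K),
      IsHamiltonian (algebraMap K _ α) (algebraMap K _ β) (X 3) (formM c d) (formL c d) δ := by
  have h : (C d * C d⁻¹ : MvPolynomial (Fin 4) K) = 1 := by
    rw [← C_mul, mul_inv_cancel₀ hd, C_1]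
  have hM : ∀ f : Fin 4 → MvPolynomial (Fin 4) K,
      mkDerivation K f (formM c d) = C c * f 3 + C d * (f 1 + f 2) := fun f => by
    simp [formM, mkDerivation_X]
  have hL : ∀ f : Fin 4 → MvPolynomial (Fin 4) K,
      mkDerivation K f (formL c d) = C c * f 3 + C d * (f 0 + f 1) := fun f => by
    simp [formL, mkDerivation_X]
  refine ⟨mkDerivation K ![C d⁻¹ * -(formL c d * (formL c d + 2 * formM c d - C β * X 3)
    - C α * X 3 ^ 2), 0, C d⁻¹ * (formM c d * (formM c d + 2 * formL c d - C β * X 3)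
    - C α * X 3 ^ 2), 0], ?_, ?_, ?_, ?_, ?_⟩
  · simp [mkDerivation_X]
  · simp
  · simp
  · rw [hM, MvPolynomial.algebraMap_eq]
    simp only [Matrix.cons_val]
    linear_combination (formM c d * (formM c d + 2 * formL c d - C β * X 3) - C α * X 3 ^ 2) * h
  · rw [hL, MvPolynomial.algebraMap_eq]
    simp only [Matrix.cons_val]
    linear_combination -(formL c d * (formL c d + 2 * formM c d - C β * X 3) - C α * X 3 ^ 2) * h

variable [CharZero K] {α β : K}

theorem exists_isTau (hd : d ≠ 0) (hα : α ≠ 0) (β : K) :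
    ∃ T : ℕ → MvPolynomial (Fin 4) K,
      IsTau (C α) (C β) (X 3) (formM c d) (formL c d) T ∧ ∀ n, (T n).IsHomogeneous (tauDeg n) := by
  have hm := isHomogeneous_formM c d
  have hl := isHomogeneous_formL c d
  have ht : (X 3 : MvPolynomial (Fin 4) K).IsHomogeneous 1 := isHomogeneous_X K 3
  have hρ : ∀ t m l : K, ∃ ρ : MvPolynomial (Fin 4) K →ₐ[K] K,
    ρ (X 3) = t ∧ ρ (formM c d) = m ∧ ρ (formL c d) = l := exists_algHom_forms hd
  have hC : ∀ (ρ : MvPolynomial (Fin 4) K →ₐ[K] K) r, ρ (C r) = r := fun ρ r => ρ.commutes r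
  obtain ⟨ρ₁, t₁, m₁, l₁⟩ := hρ 1 0 1
  obtain ⟨ρ₂, t₂, m₂, l₂⟩ := hρ 1 1 0
  obtain ⟨ρ₃, t₃, m₃, l₃⟩ := hρ 0 1 1
  obtain ⟨ρ₄, t₄, m₄, l₄⟩ := hρ 1 0 0
  have m0 : formM c d ≠ 0 := fun h => by simp [h] at m₂
  have l0 : formL c d ≠ 0 := fun h => by simp [h] at l₁
  set u : MvPolynomial (Fin 4) K :=
    C α * X 3 ^ 2 - formM c d * (formL c d + formM c d - C β * X 3) with hu
  have hu0 : u ≠ 0 := fun h => by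
    have := congrArg ρ₄ h
    simp [hu, hC, t₄, m₄, l₄, hα] at this
  obtain ⟨h5, hT⟩ := somos_rel_window (A := -(C α * X 3 ^ 2))
    (B := -cubicInv (C α) (C β) (X 3) (formM c d) (formL c d)) hu0
    (by
      refine (IsRelPrime.mul_left ((hα.isUnit.map C).isRelPrime_left)
        (IsRelPrime.pow_left (isRelPrime_of_map ht (X_ne_zero 3) ρ₃ t₃ ?_))).neg_left
      simp [cubicInv, hC, t₃, m₃, l₃])
    (isRelPrime_of_map hm m0 ρ₁ m₁ (by simp [l₁]))
    (isRelPrime_of_map hm m0 ρ₁ m₁ (by simp [hC, t₁, hα]))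
    (isRelPrime_of_map hm m0 ρ₁ m₁ (by simp [cubicInv, hC, t₁, m₁, l₁, hα]))
    (isRelPrime_of_map hl l0 ρ₂ l₂ (by simp [hC, t₂, hα]))
    (isRelPrime_of_map hl l0 ρ₂ l₂ (by simp [cubicInv, hC, t₂, m₂, l₂, hα]))
    (by rw [hu, cubicInv]; ring)
    (⟨C α * X 3 ^ 2 - formL c d * (formL c d + formM c d - C β * X 3), by rw [cubicInv]; ring⟩)
  set T := somos (-(C α * X 3 ^ 2))
    (-cubicInv (C α) (C β) (X 3) (formM c d) (formL c d)) u (formM c d) with hTdef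
  have pt : ∀ i, 1 ≤ i → IsRelPrime (T i) (X 3) := fun i hi => by
    obtain ⟨i, rfl⟩ := Nat.exists_eq_add_of_le' hi
    refine ((hT i).2.left 0 (by lia)).of_dvd_right ⟨-(C α * X 3), by ring⟩
  have hτ : IsTau (C α) (C β) (X 3) (formM c d) (formL c d) T := by
    refine ⟨by rw [hTdef, somos], by rw [hTdef, somos], by rw [hTdef, somos],
      by rw [hTdef, somos], h5, fun n => (hT n).1, fun i j hi hij hj => ?_, pt, fun i hi h0 => ?_⟩
    · obtain ⟨i, rfl⟩ := Nat.exists_eq_add_of_le' hi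
      obtain ⟨j, rfl⟩ := Nat.exists_eq_add_of_le hij.le
      exact (hT i).2.pair 0 j (by lia) (by lia)
    · have := pt i hi
      rw [h0, isRelPrime_zero_left] at this
      exact (irreducible_of_isHomogeneous_one ht (X_ne_zero 3)).not_isUnit this
  have e0 : T 0 = u := by rw [hTdef, somos]
  refine ⟨T, hτ, hτ.isHomogeneous (by rwa [e0]) (isHomogeneous_C _ _) (isHomogeneous_C _ _)
    ht hm hl ?_⟩
  rw [e0]
  exact ((ht.pow 2).C_mul α).sub (hm.mul ((hl.add hm).sub (ht.C_mul β)))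

theorem IsTau.not_dvd_of_ne {T : ℕ → MvPolynomial (Fin 4) K} (hd : d ≠ 0) (hα : α ≠ 0)
    (h : IsTau (C α) (C β) (X 3) (formM c d) (formL c d) T) {q : MvPolynomial (Fin 4) K}
    (hq : Prime q) {k : ℕ} (hk : q ∣ T (k + 5)) {i : ℕ} (hi : 2 ≤ i) (hik : i ≠ k + 5) :
    ¬ q ∣ T i := by
  obtain ⟨ρ, hρt, hρm, hρl⟩ := exists_algHom_forms (c := c) hd (1 : Polynomial K) 0 Polynomial.X
  obtain ⟨δ, hδ⟩ := exists_isHamiltonian (c := c) hd α β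
  have key : ∀ {n j}, q ∣ T (n + 5) → n + 5 < j → ¬ q ∣ T j := fun hn hj =>
    IsTau.not_dvd_of_dvd h hα hδ ρ hρt hρm hρl hq hn hj
  have h1 : ¬ q ∣ 1 := fun h => hq.not_isUnit (isUnit_of_dvd_one h)
  obtain hlt | hlt := hik.lt_or_gt
  · intro hdvd
    match i, hi, hlt, hdvd with
    | 2, _, _, hdvd => exact h1 (h.two ▸ hdvd)
    | 3, _, _, hdvd => exact h1 (h.three ▸ hdvd)
    | 4, _, _, hdvd => exact h1 (h.four ▸ hdvd)
    | i + 5, _, hlt, hdvd => exact key hdvd hlt hk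
  · exact key hk hlt

theorem IsTau.isUnit_of_forall_dvd_reduced {T : ℕ → MvPolynomial (Fin 4) K} (hd : d ≠ 0)
    (hα : α ≠ 0) (h : IsTau (C α) (C β) (X 3) (formM c d) (formL c d) T) (n : ℕ)
    {g : MvPolynomial (Fin 4) K}
    (hg : ∀ i, g ∣ reduced (C c) (C d⁻¹) (X 3) (X 2) T n i) : IsUnit g := by
  by_contra hu
  have hg0 : g ≠ 0 := fun h0 => by
    refine mul_ne_zero (X_ne_zero (R := K) (3 : Fin 4)) (Finset.prod_ne_zero_iff.2 fun i _ =>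
      h.ne_zero (i + 2) (by lia)) (zero_dvd_iff.1 (h0 ▸ hg 3))
  obtain ⟨q, hq, hqg⟩ := WfDvdMonoid.exists_irreducible_factor hu hg0
  have hq2 : ¬ q ∣ 2 := fun h2 => hq.not_isUnit (isUnit_of_dvd_unit h2 (by
    simpa only [map_ofNat] using
      (two_ne_zero (α := K)).isUnit.map (C : K →+* MvPolynomial (Fin 4) K)))
  exact h.not_forall_dvd_reduced (d := C d) (by rw [← C_mul, mul_inv_cancel₀ hd, C_1]) hq.prime hq2
    (fun k hk i hi hik => h.not_dvd_of_ne hd hα hq.prime hk hi hik) n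
    fun i => hqg.trans (hg i)

end Linear

section Iterates

theorem pd_ne_zero : pd ≠ 0 :=
  (map_ne_zero_iff _ (IsFractionRing.injective (MvPolynomial (Fin 4) ℚ) Kfield)).2 (X_ne_zero 3)

/-- The parameter `al` of the map in the chart coordinates. -/
noncomputable def chartAlpha : Kfield := pb * pc - pc ^ 2 - pa * pd

/-- The parameter `be` of the map in the chart coordinates. -/
noncomputable def chartBeta : Kfield := 4 * pc - pb

theorem chartAlpha_ne_zero : chartAlpha ≠ 0 := by
  have h : chartAlpha = algebraMap (MvPolynomial (Fin 4) ℚ) Kfield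
      (X 1 * X 2 - X 2 ^ 2 - X 0 * X 3) := by
    simp [chartAlpha, pa, pb, pc, pd]
  rw [h]
  refine (map_ne_zero_iff _ (IsFractionRing.injective (MvPolynomial (Fin 4) ℚ) Kfield)).2
    fun h0 => ?_
  have := congrArg (eval ![(0 : ℚ), 0, 1, 0]) h0
  simp at this

theorem rawIter_succ_of_eq_mul {n : ℕ} {g : MvPolynomial (Fin 4) Kfield}
    {T : ℕ → MvPolynomial (Fin 4) Kfield}
    (hT : IsTau (C chartAlpha) (C chartBeta) (X 3) (formM pc pd) (formL pc pd) T)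
    (hg : ∀ i, rawIter n i = g * reduced (C pc) (C pd⁻¹) (X 3) (X 2) T n i) (i : Fin 4) :
    rawIter (n + 1) i =
      g ^ 2 * cancelled T n * reduced (C pc) (C pd⁻¹) (X 3) (X 2) T (n + 1) i := by
  have hα : (C chartAlpha : MvPolynomial (Fin 4) Kfield) =
      C pb * C pc - C pc ^ 2 - C pa * C pd := by
    simp [chartAlpha]
  have hβ : (C chartBeta : MvPolynomial (Fin 4) Kfield) = 4 * C pc - C pb := by
    rw [chartBeta, C_sub, C_mul, map_ofNat]
  rw [hα, hβ] at hT
  obtain ⟨e0, e1, e2, e3⟩ := hT.map_reduced (z := X 2) (d' := C pd⁻¹)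
    (by rw [← C_mul, mul_inv_cancel₀ pd_ne_zero, C_1]) n rfl rfl rfl rfl
  have hC : ∀ r : Kfield, MvPolynomial.aeval (rawIter n) (C r) = C r := fun r => aeval_C _ _
  rw [rawIter]
  fin_cases i
  · simp only [phiT, Fin.mk_zero, Matrix.cons_val, map_add, map_sub, map_mul, map_neg,
      map_pow, map_ofNat, aeval_X, hC, hg]
    linear_combination g ^ 2 * e0
  · simp only [phiT, Fin.mk_one, Matrix.cons_val, map_add, map_mul, aeval_X, hC, hg]
    linear_combination g ^ 2 * e1
  · simp only [phiT, Fin.reduceFinMk, Matrix.cons_val, map_add, map_mul, aeval_X, hC, hg]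
    linear_combination g ^ 2 * e2
  · simp only [phiT, Fin.reduceFinMk, Matrix.cons_val, map_add, map_mul, aeval_X, hC, hg]
    linear_combination g ^ 2 * e3

theorem reduced_zero {T : ℕ → MvPolynomial (Fin 4) Kfield}
    (hT : IsTau (C chartAlpha) (C chartBeta) (X 3) (formM pc pd) (formL pc pd) T) (i : Fin 4) :
    reduced (C pc) (C pd⁻¹) (X 3) (X 2) T 0 i = X i := by
  have hd : (C pd * C pd⁻¹ : MvPolynomial (Fin 4) Kfield) = 1 := by
    rw [← C_mul, mul_inv_cancel₀ pd_ne_zero, C_1]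
  have h1 : numer (C pc) (C pd⁻¹) (X 3) (X 2) T 1 = X 1 := by
    simp only [numer, Finset.prod_range_zero, Finset.prod_range_succ, zero_add, hT.one, hT.two,
      hT.three, hT.four, formM]
    linear_combination (X 1 + X 2) * hd
  have h2 : numer (C pc) (C pd⁻¹) (X 3) (X 2) T 2 = X 0 := by
    rw [numer, h1]
    simp only [Finset.prod_range_zero, Finset.prod_range_succ, zero_add, Nat.reduceAdd, hT.two,
      hT.three, hT.four, hT.five, formL]
    linear_combination (X 0 + X 1) * hd
  fin_cases i
  · exact h2
  · simp [reduced, h1, hT.four]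
  · simp [reduced, numer, hT.three, hT.four]
  · simp [reduced, Finset.prod_range_succ, hT.two, hT.three, hT.four]

theorem exists_rawIter_eq_mul {T : ℕ → MvPolynomial (Fin 4) Kfield}
    (hT : IsTau (C chartAlpha) (C chartBeta) (X 3) (formM pc pd) (formL pc pd) T) (n : ℕ) :
    ∃ g : MvPolynomial (Fin 4) Kfield, g ≠ 0 ∧
      ∀ i, rawIter n i = g * reduced (C pc) (C pd⁻¹) (X 3) (X 2) T n i := by
  induction n with
  | zero => exact ⟨1, one_ne_zero, fun i => by rw [reduced_zero hT, one_mul, rawIter]⟩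
  | succ n ih =>
    obtain ⟨g, hg0, hg⟩ := ih
    have hne : ∀ i, T (i + 2) ≠ 0 := fun i => hT.ne_zero _ (by lia)
    exact ⟨g ^ 2 * cancelled T n, mul_ne_zero (pow_ne_zero 2 hg0) (mul_ne_zero
      (Finset.prod_ne_zero_iff.2 fun i _ => hne i) (hne n)), rawIter_succ_of_eq_mul hT hg⟩

end Iterates

end CubicGrowth

/-- Theorem 3 (cubic degree growth): the common degree `d n` of the four homogeneous
components of the reduced `n`-th iterate of φ̃ (the raw iterate divided by the gcd of
its components) equals `17/16 + (5/12)n + (3/8)n² + (1/12)n³ − (1/16)(−1)ⁿ`; in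
particular the degree growth is cubic and the algebraic entropy
`lim (1/n)·log d_n` is zero. -/
theorem cubic_degree_growth :
    ∃ d : ℕ → ℕ,
      (∀ n, ∃ p : Fin 4 → MvPolynomial (Fin 4) Kfield,
        (∃ g : MvPolynomial (Fin 4) Kfield, g ≠ 0 ∧ ∀ i, rawIter n i = g * p i) ∧
        (∀ h : MvPolynomial (Fin 4) Kfield, (∀ i, h ∣ p i) → IsUnit h) ∧
        (∀ i, (p i).IsHomogeneous (d n))) ∧
      (∀ n, (d n : ℚ) =
        17 / 16 + (5 / 12) * n + (3 / 8) * n ^ 2 + (1 / 12) * n ^ 3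
          - (1 / 16) * (-1) ^ n) ∧
      Filter.Tendsto (fun n : ℕ => Real.log (d n) / n) Filter.atTop (nhds 0) := by
  obtain ⟨T, hT, hdeg⟩ := CubicGrowth.exists_isTau (c := pc) CubicGrowth.pd_ne_zero
    CubicGrowth.chartAlpha_ne_zero CubicGrowth.chartBeta
  exact ⟨fun n => 1 + ∑ i ∈ Finset.range (n + 3), CubicGrowth.tauDeg (i + 2),
    fun n => ⟨CubicGrowth.reduced (C pc) (C pd⁻¹) (X 3) (X 2) T n,
      CubicGrowth.exists_rawIter_eq_mul hT n,
      fun h hh => hT.isUnit_of_forall_dvd_reduced CubicGrowth.pd_ne_zero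
        CubicGrowth.chartAlpha_ne_zero n hh,
      CubicGrowth.isHomogeneous_reduced hdeg (isHomogeneous_C _ _) (isHomogeneous_C _ _)
        (isHomogeneous_X _ _) (isHomogeneous_X _ _) n⟩,
    CubicGrowth.one_add_sum_tauDeg,
    CubicGrowth.tendsto_log_div_of_le_pow 3 CubicGrowth.one_add_sum_tauDeg_le⟩
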